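/- For every Dyck path a, f(uad) = Σ_{s ≥ a} V(a,s) · I(s), where the sum is over all Dyck paths s of length |a| with s ≥ a, and I(s) = |[s, u^{|s|/2} d^{|s|/2}]| is the cardinality of the interval from s to the pyramid of the same length in the lattice of binary paths. -/

import Mathlib

/-- A binary path is a list of steps: `true` = upstep `u`, `false` = downstep `d`. -/
abbrev BinPath := List Bool

/-- `ht P k` is the height of the `k`-th point of the path `P` (the point reached
after the first `k` steps). -/
def ht (P : BinPath) (k : ℕ) : ℤ :=
  ((P.take k).map (fun b => if b then (1 : ℤ) else -1)).sum

/-- The lattice order on binary paths of the same length: `P ≤ Q` iff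
`hᵢ(P) ≤ hᵢ(Q)` for all `i`. -/
def pathLe (P Q : BinPath) : Prop :=
  P.length = Q.length ∧ ∀ k, ht P k ≤ ht Q k

def pathLt (P Q : BinPath) : Prop := pathLe P Q ∧ P ≠ Q

/-- The maximum path `1ₙ = uⁿ`. -/
def maxPath (n : ℕ) : BinPath := List.replicate n true

/-- Step `i` (0-based) of `P` is a downstep whose endpoint is a valley, i.e. it is
followed by an upstep or it is the last step of `P`. -/
def isValley (P : BinPath) (i : ℕ) : Prop :=
  i < P.length ∧ P.getD i true = false ∧ P.getD (i + 1) true = true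

/-- The number of valleys of `P`. -/
def numValleys (P : BinPath) : ℕ :=
  ((Finset.range P.length).filter
    (fun i => P.getD i true = false ∧ P.getD (i + 1) true = true)).card

/-- The filling of `P`: every valley of `P` is turned into a peak
(each occurrence `du` whose middle point is a valley becomes `ud`, and a final
valley-`d` becomes `u`). -/
def fill (P : BinPath) : BinPath :=
  List.ofFn (fun i : Fin P.length =>
    if P.get i then P.getD (i.1 - 1) true else P.getD (i.1 + 1) true)

/-- The degree of `P`: the least `k` such that the `k`-fold iterated filling
of `P` is the maximum path. -/
noncomputable def degree (P : BinPath) : ℕ :=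
  sInf {k | fill^[k] P = maxPath P.length}

/-- `fPath P` is the number of chains from `P` to the maximum path `1_{|P|}` of
length `degree P` having small intervals. -/
noncomputable def fPath (P : BinPath) : ℕ :=
  Set.ncard {c : ℕ → BinPath |
    c 0 = P ∧ (∀ i, degree P ≤ i → c i = maxPath P.length) ∧
    ∀ i < degree P, pathLt (c i) (c (i + 1)) ∧ pathLe (c (i + 1)) (fill (c i))}

/-- Height of the lowest valley of `P`. -/
noncomputable def lv (P : BinPath) : ℤ :=
  sInf {h : ℤ | ∃ i, isValley P i ∧ ht P (i + 1) = h}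

/-- Height of the highest valley of `P`. -/
noncomputable def hv (P : BinPath) : ℤ :=
  sSup {h : ℤ | ∃ i, isValley P i ∧ ht P (i + 1) = h}

noncomputable def hvNat (P : BinPath) : ℕ := (hv P).toNat

/-- `P′`: every low valley of `P` is turned into a peak. -/
noncomputable def lowFill (P : BinPath) : BinPath :=
  List.ofFn (fun i : Fin P.length =>
    if P.get i then
      (if P.getD (i.1 - 1) true = false ∧ ht P i.1 = lv P then false else true)
    else
      (if P.getD (i.1 + 1) true = true ∧ ht P (i.1 + 1) = lv P then true else false))

/-- `P*`: every valley of `P` is turned into a peak, except the last one when `P`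
ends with a downstep. -/
def starFill (P : BinPath) : BinPath :=
  List.ofFn (fun i : Fin P.length =>
    if i.1 + 1 = P.length ∧ P.get i = false then false
    else if P.get i then P.getD (i.1 - 1) true else P.getD (i.1 + 1) true)

/-- A Dyck path: starts and ends at height 0 and lies weakly above height 0. -/
def IsDyck (P : BinPath) : Prop := ht P P.length = 0 ∧ ∀ k, 0 ≤ ht P k

/-- A Dyck prefix: a prefix of a Dyck path. -/
def IsDyckPrefix (P : BinPath) : Prop := ∃ Q : BinPath, IsDyck (P ++ Q)

/-- A Dyck suffix: a suffix of a Dyck path. -/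
def IsDyckSuffix (P : BinPath) : Prop := ∃ Q : BinPath, IsDyck (Q ++ P)

/-- The pyramid `u^m d^m`. -/
def pyramid (m : ℕ) : BinPath := List.replicate m true ++ List.replicate m false

/-- Cardinality of the interval `[P, Q]` in the lattice of binary paths. -/
noncomputable def intervalCard (P Q : BinPath) : ℕ :=
  Set.ncard {R : BinPath | pathLe P R ∧ pathLe R Q}

/-- `I(s) = |[s, u^{|s|/2} d^{|s|/2}]|`. -/
noncomputable def Ifun (s : BinPath) : ℕ := intervalCard s (pyramid (s.length / 2))

/-- `J(P) = |[P, u^{|P|}]|`. -/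
noncomputable def Jfun (P : BinPath) : ℕ := intervalCard P (maxPath P.length)

/-- `P` and `Q` have exactly the same valleys at every height at most `m`. -/
def sameValleysUpTo (P Q : BinPath) (m : ℤ) : Prop :=
  ∀ (i : ℕ) (t : ℤ), t ≤ m →
    ((isValley P i ∧ ht P (i + 1) = t) ↔ (isValley Q i ∧ ht Q (i + 1) = t))

/-- A multichain of Dyck paths of type `V` from `a` to `s`: it has length
`h = hv(a)` and for every `j ∈ [h]` its `(j-1)`-st and `j`-th members have the
same valleys at every height at most `h - j`.  (The function `σ` is frozen from
index `h` on, so that such multichains are counted correctly.) -/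
def IsVChain (a s : BinPath) (σ : ℕ → BinPath) : Prop :=
  σ 0 = a ∧ (∀ j, hvNat a ≤ j → σ j = s) ∧ (∀ j, IsDyck (σ j)) ∧
  (∀ j < hvNat a, pathLe (σ j) (σ (j + 1))) ∧
  (∀ j, 1 ≤ j → j ≤ hvNat a →
    sameValleysUpTo (σ (j - 1)) (σ j) ((hvNat a : ℤ) - (j : ℤ)))

/-- `V(a,s)`: the number of `a`–`s` multichains of type `V`. -/
noncomputable def VPath (a s : BinPath) : ℕ :=
  Set.ncard {σ : ℕ → BinPath | IsVChain a s σ}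

/-- `ζ^k(P,Q)`: the number of `P`–`Q` multichains of length `k`. -/
noncomputable def zetaPow (k : ℕ) (P Q : BinPath) : ℕ :=
  Set.ncard {c : ℕ → BinPath |
    c 0 = P ∧ (∀ i, k ≤ i → c i = Q) ∧ ∀ i < k, pathLe (c i) (c (i + 1))}

/-- The join of two paths of the same length (pointwise max of heights). -/
def pathSup (P Q : BinPath) : BinPath :=
  List.ofFn (fun i : Fin P.length =>
    decide (max (ht P i.1) (ht Q i.1) < max (ht P (i.1 + 1)) (ht Q (i.1 + 1))))

/-- The meet of two paths of the same length (pointwise min of heights). -/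
def pathInf (P Q : BinPath) : BinPath :=
  List.ofFn (fun i : Fin P.length =>
    decide (min (ht P i.1) (ht Q i.1) < min (ht P (i.1 + 1)) (ht Q (i.1 + 1))))

/-- `Q` covers `P` in the lattice of binary paths. -/
def pathCovBy (P Q : BinPath) : Prop :=
  pathLt P Q ∧ ∀ R : BinPath, pathLt P R → pathLt R Q → False

/-- `l(P,Q) = (1/2)·Σᵢ (hᵢ(Q) − hᵢ(P))`. -/
def lpq (P Q : BinPath) : ℕ :=
  ((∑ i ∈ Finset.range P.length, (ht Q (i + 1) - ht P (i + 1))) / 2).toNat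

/-- Convolution in the incidence algebra of the lattice of binary paths. -/
noncomputable def conv (F G : BinPath → BinPath → ℤ) : BinPath → BinPath → ℤ :=
  fun P Q => ∑ᶠ (R : BinPath) (_ : pathLe P R ∧ pathLe R Q), F P R * G R Q

/-- The delta function of the incidence algebra. -/
def deltaFun : BinPath → BinPath → ℤ := fun P Q => if P = Q then 1 else 0

/-- `μ^k`: the `k`-th convolution power of `μ` (`μ^0` is the delta function). -/
noncomputable def muPow (mu : BinPath → BinPath → ℤ) (k : ℕ) : BinPath → BinPath → ℤ :=
  (conv mu)^[k] deltaFun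

/-- The number of downsteps among the first `x` steps of `P`. -/
def downCount (P : BinPath) (x : ℕ) : ℕ := (P.take x).count false

lemma downCount_zero (P : BinPath) : downCount P 0 = 0 := by simp [downCount]

lemma downCount_succ (P : BinPath) (x : ℕ) :
    downCount P (x + 1) = downCount P x + if P.getD x true = false then 1 else 0 := by
  unfold downCount
  rcases lt_or_ge x P.length with hx | hx
  · rw [List.take_succ_eq_append_getElem hx, List.count_append]
    simp [List.count_singleton, hx]
  · rw [List.take_of_length_le hx, List.take_of_length_le (by omega)]
    rw [List.getD_eq_default _ _ hx]
    simp

lemma downCount_le_succ (P : BinPath) (x : ℕ) : downCount P x ≤ downCount P (x + 1) := by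
  rw [downCount_succ]; omega

lemma downCount_succ_le (P : BinPath) (x : ℕ) : downCount P (x + 1) ≤ downCount P x + 1 := by
  rw [downCount_succ]; split_ifs <;> omega

lemma getD_eq_false_iff (P : BinPath) (x : ℕ) :
    P.getD x true = false ↔ downCount P (x + 1) = downCount P x + 1 := by
  rw [downCount_succ]; split_ifs with h <;> simp [h, -List.getD_eq_getElem?_getD]

lemma getD_eq_true_iff (P : BinPath) (x : ℕ) :
    P.getD x true = true ↔ downCount P (x + 1) = downCount P x := by
  rw [downCount_succ]; cases P.getD x true <;> simp

lemma downCount_le (P : BinPath) (x : ℕ) : downCount P x ≤ x := by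
  induction x with
  | zero => simp [downCount_zero]
  | succ x ih => have := downCount_succ_le P x; omega

lemma ht_succ (P : BinPath) (x : ℕ) (hx : x < P.length) :
    ht P (x + 1) = ht P x + if P.getD x true = false then -1 else 1 := by
  unfold ht
  rw [List.take_succ_eq_append_getElem hx]
  simp only [List.map_append, List.sum_append, List.getD_eq_getElem _ _ hx]
  cases P[x] <;> simp

lemma ht_eq_sub_downCount (P : BinPath) (x : ℕ) (hx : x ≤ P.length) :
    ht P x = x - 2 * downCount P x := by
  induction x with
  | zero => simp [ht, downCount_zero]
  | succ x ih =>
    rw [ht_succ P x hx, ih (by omega), downCount_succ]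
    split_ifs <;> push_cast <;> ring

lemma ht_of_length_le (P : BinPath) (x : ℕ) (hx : P.length ≤ x) : ht P x = ht P P.length := by
  simp [ht, List.take_of_length_le hx]

lemma eq_of_downCount_eq {P Q : BinPath} (hl : P.length = Q.length)
    (h : ∀ x ≤ P.length, downCount P x = downCount Q x) : P = Q := by
  apply List.ext_getElem hl
  intro i h1 h2
  rw [← List.getD_eq_getElem _ true h1, ← List.getD_eq_getElem _ true h2]
  have hP := getD_eq_false_iff P i
  have hQ := getD_eq_false_iff Q i
  rw [h i (by omega), h (i + 1) (by omega), ← hQ] at hP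
  rcases hp : P.getD i true <;> rcases hq : Q.getD i true <;> simp_all

lemma pathLe_iff_downCount (P Q : BinPath) :
    pathLe P Q ↔ P.length = Q.length ∧ ∀ x ≤ P.length, downCount Q x ≤ downCount P x := by
  refine and_congr_right fun hl => ⟨fun h x hx => ?_, fun h x => ?_⟩
  · have := h x
    rw [ht_eq_sub_downCount P x hx, ht_eq_sub_downCount Q x (hl ▸ hx)] at this
    omega
  · rcases le_total x P.length with hx | hx
    · have := h x hx
      rw [ht_eq_sub_downCount P x hx, ht_eq_sub_downCount Q x (hl ▸ hx)]
      omega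
    · have := h P.length le_rfl
      rw [ht_of_length_le P x hx, ht_of_length_le Q x (hl ▸ hx), ← hl,
        ht_eq_sub_downCount P _ le_rfl, ht_eq_sub_downCount Q _ hl.le]
      omega

lemma isDyck_iff_downCount (P : BinPath) :
    IsDyck P ↔ P.length = 2 * downCount P P.length ∧
      ∀ x ≤ P.length, 2 * downCount P x ≤ x := by
  unfold IsDyck
  rw [ht_eq_sub_downCount P _ le_rfl]
  refine and_congr (by omega) ⟨fun h x hx => ?_, fun h x => ?_⟩
  · have := h x
    rw [ht_eq_sub_downCount P x hx] at this
    omega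
  · rcases le_total x P.length with hx | hx
    · have := h x hx
      rw [ht_eq_sub_downCount P x hx]
      omega
    · have := h P.length le_rfl
      rw [ht_of_length_le P x hx, ht_eq_sub_downCount P _ le_rfl]
      omega

lemma downCount_maxPath (n x : ℕ) : downCount (maxPath n) x = 0 := by
  simp [downCount, maxPath, List.take_replicate, List.count_replicate]

lemma eq_maxPath_of_downCount {P : BinPath} (h : ∀ x ≤ P.length, downCount P x = 0) :
    P = maxPath P.length :=
  eq_of_downCount_eq (by simp [maxPath]) fun x hx => by rw [h x hx, downCount_maxPath]

lemma isValley_iff_downCount (P : BinPath) (i : ℕ) :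
    isValley P i ↔ downCount P (i + 1) = downCount P i + 1 ∧
      downCount P (i + 2) = downCount P (i + 1) := by
  unfold isValley
  rw [getD_eq_false_iff, getD_eq_true_iff]
  refine ⟨fun h => h.2, fun h => ⟨?_, h⟩⟩
  by_contra hi
  have := (getD_eq_false_iff P i).2 h.1
  rw [List.getD_eq_default _ _ (by omega)] at this
  simp at this

/-! ### Paths cut out by families of predicates -/

open Classical in
/-- The path of length `N` having at least `k` downsteps among its first `x` steps
exactly when `E x k` holds, for suitable `E`. -/
noncomputable def pathOf (N : ℕ) (E : ℕ → ℕ → Prop) : BinPath :=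
  List.ofFn fun i : Fin N =>
    decide (Nat.findGreatest (E (i + 1)) (i + 1) = Nat.findGreatest (E i) i)

lemma length_pathOf (N : ℕ) (E : ℕ → ℕ → Prop) : (pathOf N E).length = N := by
  simp [pathOf]

lemma le_downCount_pathOf {N : ℕ} {E : ℕ → ℕ → Prop} (h0 : ∀ k, 1 ≤ k → ¬ E 0 k)
    (h1 : ∀ x k, x < N → 1 ≤ k → E x k → E (x + 1) k)
    (h2 : ∀ x k, x < N → 1 ≤ k → E (x + 1) (k + 1) → E x k) {x k : ℕ} (hx : x ≤ N)
    (hk : 1 ≤ k) : k ≤ downCount (pathOf N E) x ↔ E x k := by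
  classical
  have hdown : ∀ x k, x ≤ N → 1 ≤ k → E x (k + 1) → E x k := by
    intro x k hx hk hE
    cases x with
    | zero => exact absurd hE (h0 _ (by omega))
    | succ x => exact h1 x k hx hk (h2 x k hx hk hE)
  have hmono : ∀ x j k, x ≤ N → 1 ≤ k → E x (k + j) → E x k := by
    intro x j k hx hk
    induction j with
    | zero => exact id
    | succ j ih => exact fun h => ih (hdown x (k + j) hx (by omega) h)
  have hbd : ∀ x k, x ≤ N → 1 ≤ k → E x k → k ≤ x := by
    intro x
    induction x with
    | zero => exact fun k _ hk h => absurd h (h0 k hk)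
    | succ x ih =>
      intro k hx hk h
      obtain ⟨k, rfl⟩ := Nat.exists_eq_succ_of_ne_zero (by omega : k ≠ 0)
      rcases Nat.eq_zero_or_pos k with rfl | hk'
      · omega
      · have := ih k (by omega) hk' (h2 x k hx hk' h)
        omega
  have hg : ∀ x k, x ≤ N → 1 ≤ k → (k ≤ Nat.findGreatest (E x) x ↔ E x k) := by
    intro x k hx hk
    constructor
    · intro h
      have hs : E x (Nat.findGreatest (E x) x) :=
        Nat.findGreatest_of_ne_zero rfl (by omega)
      obtain ⟨j, hj⟩ := Nat.exists_eq_add_of_le h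
      rw [hj] at hs
      exact hmono x j k hx hk hs
    · exact fun h => Nat.le_findGreatest (hbd x k hx hk h) h
  have hle : ∀ x < N, Nat.findGreatest (E x) x ≤ Nat.findGreatest (E (x + 1)) (x + 1) := by
    intro x hx
    rcases Nat.eq_zero_or_pos (Nat.findGreatest (E x) x) with h | h
    · omega
    · exact (hg _ _ hx h).2 (h1 x _ hx h ((hg x _ hx.le h).1 le_rfl))
  have hle' : ∀ x < N, Nat.findGreatest (E (x + 1)) (x + 1) ≤ Nat.findGreatest (E x) x + 1 := by
    intro x hx
    by_contra! h
    have h3 := h2 x (Nat.findGreatest (E x) x + 1) hx (by omega) ((hg _ _ hx (by omega)).1 h)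
    have := (hg x _ hx.le (by omega)).2 h3
    omega
  have hd : ∀ x ≤ N, downCount (pathOf N E) x = Nat.findGreatest (E x) x := by
    intro x
    induction x with
    | zero => simp [downCount_zero]
    | succ x ih =>
      intro hx
      have e1 := hle x hx
      have e2 := hle' x hx
      rw [downCount_succ, ih (by omega),
        List.getD_eq_getElem _ _ (by rw [length_pathOf]; omega)]
      simp only [pathOf, List.getElem_ofFn, decide_eq_false_iff_not]
      split_ifs <;> omega
  rw [hd x hx, hg x k hx hk]

/-! ### Fillings and degrees -/

lemma length_fill (P : BinPath) : (fill P).length = P.length := by simp [fill]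

lemma downCount_fill (P : BinPath) (x : ℕ) (hx : x ≤ P.length) :
    downCount (fill P) x +
      (if 1 ≤ x ∧ P.getD (x - 1) true = false ∧ P.getD x true = true then 1 else 0) =
      downCount P x := by
  induction x with
  | zero => simp [downCount_zero]
  | succ x ih =>
    have ih := ih (by omega)
    have hf : (fill P).getD x true =
        if P.getD x true = true then P.getD (x - 1) true else P.getD (x + 1) true := by
      rw [List.getD_eq_getElem _ _ (by rw [length_fill]; omega),
        List.getD_eq_getElem P true (show x < P.length by omega)]
      simp [fill]
    rw [downCount_succ, downCount_succ P, hf]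
    cases x with
    | zero =>
      simp only [downCount_zero, Nat.zero_add, Nat.sub_self] at *
      cases h1 : P.getD 0 true <;> cases h2 : P.getD 1 true <;> simp
    | succ x =>
      simp only [Nat.add_sub_cancel] at *
      cases h1 : P.getD x true <;> cases h2 : P.getD (x + 1) true <;>
        cases h3 : P.getD (x + 1 + 1) true <;> simp_all

lemma pathLe_fill_iff {P Q : BinPath} (hl : Q.length = P.length) :
    pathLe Q (fill P) ↔
      (∀ x < P.length, downCount P x ≤ downCount Q (x + 1)) ∧
      ∀ x < P.length, downCount P (x + 1) ≤ downCount Q x + 1 := by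
  rw [pathLe_iff_downCount, length_fill]
  constructor
  · rintro ⟨-, h⟩
    refine ⟨fun x hx => ?_, fun x hx => ?_⟩
    · have h1 := h (x + 1) (by omega)
      have h2 := downCount_fill P (x + 1) (by omega)
      have h3 := downCount_succ P x
      simp only [Nat.add_sub_cancel] at h2
      cases h4 : P.getD x true <;> simp [h4, -List.getD_eq_getElem?_getD] at h2 h3 <;>
        (try split_ifs at h2) <;> omega
    · have h1 := h x (by omega)
      have h2 := downCount_fill P x (by omega)
      have h3 := downCount_succ P x
      cases h4 : P.getD x true <;> simp [h4, -List.getD_eq_getElem?_getD] at h2 h3 <;>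
        (try split_ifs at h2) <;> omega
  · rintro ⟨h1, h2⟩
    refine ⟨hl, fun x hx => ?_⟩
    have h3 := downCount_fill P x (by omega)
    cases x with
    | zero => simp [downCount_zero]
    | succ x =>
      have h4 := h1 x (by omega)
      have h5 := downCount_succ P x
      have h6 := downCount_succ P (x + 1)
      simp only [Nat.add_sub_cancel] at h3
      by_cases hx' : x + 1 < P.length
      · have h7 := h2 (x + 1) hx'
        cases h8 : P.getD x true <;> cases h9 : P.getD (x + 1) true <;>
          simp [h8, h9, -List.getD_eq_getElem?_getD] at h3 h5 h6 <;> omega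
      · rw [List.getD_eq_default P _ (show P.length ≤ x + 1 by omega)] at h3
        cases h8 : P.getD x true <;> simp [h8, -List.getD_eq_getElem?_getD] at h3 h5 <;> omega

/-- The height functions (in terms of downstep counts) of a multichain of paths of
length `N` with small intervals. -/
structure IsSmallDescent (N : ℕ) (F : ℕ → ℕ → ℕ) : Prop where
  zero : ∀ t, F t 0 = 0
  anti : ∀ t x, x ≤ N → F (t + 1) x ≤ F t x
  right : ∀ t x, x < N → F t x ≤ F (t + 1) (x + 1)
  left : ∀ t x, x < N → F t (x + 1) ≤ F (t + 1) x + 1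

namespace IsSmallDescent

variable {N : ℕ} {F : ℕ → ℕ → ℕ}

lemma anti' (hF : IsSmallDescent N F) {t t' x : ℕ} (hx : x ≤ N) (h : t ≤ t') :
    F t' x ≤ F t x := by
  induction t', h using Nat.le_induction with
  | base => rfl
  | succ t' _ ih => exact (hF.anti t' x hx).trans ih

lemma right_add (hF : IsSmallDescent N F) (t x s : ℕ) (hx : x + s ≤ N) :
    F t x ≤ F (t + s) (x + s) := by
  induction s with
  | zero => rfl
  | succ s ih => exact (ih (by omega)).trans (hF.right (t + s) (x + s) (by omega))

lemma last_le (hF : IsSmallDescent N F) (hN : 1 ≤ N) (t i : ℕ) :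
    F t N ≤ F (t + 2 * i) N + i := by
  induction i with
  | zero => rfl
  | succ i ih =>
    have h1 := hF.left (t + 2 * i) (N - 1) (by omega)
    have h2 := hF.right (t + 2 * i + 1) (N - 1) (by omega)
    rw [Nat.sub_add_cancel hN] at h1 h2
    rw [show t + 2 * (i + 1) = t + 2 * i + 1 + 1 by ring]
    omega

/-- If the multichain reaches the maximum path after `N - 1` steps, then the `t`-th path has no
valley at height less than `t`. -/
lemma add_two_mul_le (hF : IsSmallDescent N F) (hend : ∀ x ≤ N, F (N - 1) x = 0)
    {t x k : ℕ} (hx : x ≤ N) (hk : 1 ≤ k) (h : k ≤ F t x) : t + 2 * k ≤ x := by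
  by_contra! hlt
  have hN : 1 ≤ N := by
    by_contra! h0
    obtain rfl : x = 0 := by omega
    rw [hF.zero] at h
    omega
  have h1 := hF.right_add t x (N - x) (by omega)
  have h2 := hF.last_le hN (t + (N - x)) (k - 1)
  have h3 := hF.anti' (t := N - 1) (t' := t + (N - x) + 2 * (k - 1)) (x := N) le_rfl (by omega)
  rw [hend N le_rfl] at h3
  rw [show x + (N - x) = N by omega] at h1
  omega

variable {m : ℕ}

lemma le_last (hF : IsSmallDescent (2 * m + 2) F) (h0 : F 0 (2 * m + 2) = m + 1) {k : ℕ}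
    (hk : k ≤ m + 1) : k ≤ F (2 * m + 2 - 2 * k) (2 * m + 2) := by
  have := hF.last_le (by omega) 0 (m + 1 - k)
  rw [show 0 + 2 * (m + 1 - k) = 2 * m + 2 - 2 * k by omega] at this
  omega

lemma le_penultimate (hF : IsSmallDescent (2 * m + 2) F) (h0 : F 0 (2 * m + 2) = m + 1)
    {k : ℕ} (hk : k ≤ m) : k ≤ F (2 * m + 1 - 2 * k) (2 * m + 1) := by
  have h1 := hF.le_last h0 (k := k + 1) (by omega)
  have h2 := hF.left (2 * m + 2 - 2 * (k + 1)) (2 * m + 1) (by omega)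
  rw [show 2 * m + 2 - 2 * (k + 1) + 1 = 2 * m + 1 - 2 * k by omega] at h2
  have : 2 * m + 1 + 1 = 2 * m + 2 := rfl
  rw [this] at h2
  omega

/-- A multichain of the shortest possible length is strict. -/
lemma exists_ne (hF : IsSmallDescent (2 * m + 2) F) (h0 : F 0 (2 * m + 2) = m + 1)
    (hend : ∀ x ≤ 2 * m + 2, F (2 * m + 1) x = 0) {t : ℕ} (ht : t < 2 * m + 1) :
    ∃ x ≤ 2 * m + 2, F t x ≠ F (t + 1) x := by
  rcases Nat.even_or_odd' t with ⟨i, rfl | rfl⟩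
  · refine ⟨2 * m + 2, le_rfl, fun h => ?_⟩
    have h1 := hF.le_last h0 (k := m + 1 - i) (by omega)
    rw [show 2 * m + 2 - 2 * (m + 1 - i) = 2 * i by omega, h] at h1
    have := hF.add_two_mul_le hend le_rfl (by omega) h1
    omega
  · refine ⟨2 * m + 1, by omega, fun h => ?_⟩
    have h1 := hF.le_penultimate h0 (k := m - i) (by omega)
    rw [show 2 * m + 1 - 2 * (m - i) = 2 * i + 1 by omega, h] at h1
    have := hF.add_two_mul_le hend (by omega) (by omega) h1
    omega

end IsSmallDescent

lemma isSmallDescent_downCount {N : ℕ} {c : ℕ → BinPath} (hl : ∀ t, (c t).length = N)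
    (h1 : ∀ t, pathLe (c t) (c (t + 1))) (h2 : ∀ t, pathLe (c (t + 1)) (fill (c t))) :
    IsSmallDescent N fun t => downCount (c t) where
  zero t := downCount_zero _
  anti t x hx := ((pathLe_iff_downCount _ _).1 (h1 t)).2 x (by rwa [hl])
  right t x hx := ((pathLe_fill_iff (by rw [hl, hl])).1 (h2 t)).1 x (by rwa [hl])
  left t x hx := ((pathLe_fill_iff (by rw [hl, hl])).1 (h2 t)).2 x (by rwa [hl])

lemma pathLe_refl (P : BinPath) : pathLe P P := ⟨rfl, fun _ => le_rfl⟩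

lemma pathLe_fill (P : BinPath) : pathLe P (fill P) :=
  (pathLe_iff_downCount _ _).2 ⟨(length_fill P).symm, fun x hx => by
    have := downCount_fill P x hx
    omega⟩

lemma length_iterate_fill (P : BinPath) (t : ℕ) : (fill^[t] P).length = P.length := by
  induction t with
  | zero => rfl
  | succ t ih => rw [Function.iterate_succ_apply', length_fill, ih]

lemma isSmallDescent_iterate_fill (P : BinPath) :
    IsSmallDescent P.length fun t => downCount (fill^[t] P) := by
  refine isSmallDescent_downCount (length_iterate_fill P) (fun t => ?_) (fun t => ?_)
  · rw [Function.iterate_succ_apply']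
    exact pathLe_fill _
  · rw [Function.iterate_succ_apply']
    exact pathLe_refl _

lemma degree_eq {P : BinPath} {m : ℕ} (hl : P.length = 2 * m + 2)
    (hc : downCount P (2 * m + 2) = m + 1) (hd : ∀ x ≤ 2 * m + 2, 2 * downCount P x ≤ x) :
    degree P = 2 * m + 1 := by
  have hF := isSmallDescent_iterate_fill P
  rw [hl] at hF
  have hb : ∀ t x k, x ≤ 2 * m + 2 → 1 ≤ k → k ≤ downCount (fill^[t] P) x → t + 2 * k ≤ x := by
    intro t
    induction t with
    | zero =>
      intro x k hx hk h
      have := hd x hx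
      rw [Function.iterate_zero_apply] at h
      omega
    | succ t ih =>
      intro x k hx hk h
      have hlt := length_iterate_fill P t
      rw [Function.iterate_succ_apply'] at h
      have h1 := downCount_fill (fill^[t] P) x (by omega)
      cases x with
      | zero =>
        rw [downCount_zero] at h
        omega
      | succ x =>
        have h2 := downCount_succ (fill^[t] P) x
        have h3 := downCount_succ (fill^[t] P) (x + 1)
        simp only [Nat.add_sub_cancel] at h1
        by_cases hx' : x + 1 < 2 * m + 2
        · by_cases h4 : k ≤ downCount (fill^[t] P) x
          · have := ih x k (by omega) hk h4
            omega
          · have := ih (x + 1 + 1) (k + 1) (by omega) (by omega) (by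
              cases h5 : (fill^[t] P).getD x true <;>
              cases h6 : (fill^[t] P).getD (x + 1) true <;>
              simp [h5, h6, -List.getD_eq_getElem?_getD] at h1 h2 h3 <;> omega)
            omega
        · rw [List.getD_eq_default _ _ (show (fill^[t] P).length ≤ x + 1 by omega)] at h1
          have := ih x k (by omega) hk (by
            cases h5 : (fill^[t] P).getD x true <;>
            simp [h5, -List.getD_eq_getElem?_getD] at h1 h2 <;> omega)
          omega
  have hmax : fill^[2 * m + 1] P = maxPath P.length := by
    rw [← length_iterate_fill P (2 * m + 1)]
    refine eq_maxPath_of_downCount fun x hx => ?_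
    by_contra hne
    rw [length_iterate_fill, hl] at hx
    have := hb _ x _ hx (Nat.one_le_iff_ne_zero.2 hne) le_rfl
    omega
  apply le_antisymm
  · exact Nat.sInf_le hmax
  · refine le_csInf ⟨2 * m + 1, hmax⟩ fun k hk => ?_
    by_contra! hlt
    have h1 := hF.le_last hc (k := 1) (by omega)
    have h2 := hF.anti' (t := k) (t' := 2 * m) (x := 2 * m + 2) le_rfl (by omega)
    rw [Set.mem_ofPred_eq] at hk
    simp only [hk, downCount_maxPath] at h2
    simp only [show 2 * m + 2 - 2 * 1 = 2 * m by omega] at h1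
    omega

/-- The chains counted by `fPath P`, in terms of downstep counts. -/
def smallChains (m : ℕ) (P : BinPath) : Set (ℕ → BinPath) :=
  {c | c 0 = P ∧ (∀ t, 2 * m + 1 ≤ t → c t = maxPath (2 * m + 2)) ∧
    (∀ t, (c t).length = 2 * m + 2) ∧ IsSmallDescent (2 * m + 2) fun t => downCount (c t)}

lemma fPath_eq_ncard_smallChains {P : BinPath} {m : ℕ} (hl : P.length = 2 * m + 2)
    (hc : downCount P (2 * m + 2) = m + 1) (hd : ∀ x ≤ 2 * m + 2, 2 * downCount P x ≤ x) :
    fPath P = (smallChains m P).ncard := by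
  unfold fPath smallChains
  rw [degree_eq hl hc hd, hl]
  congr 1
  ext c
  simp only [Set.mem_ofPred_eq]
  refine and_congr_right fun h0 => and_congr_right fun hend => ⟨fun h => ?_, ?_⟩
  · have hlen : ∀ t, (c t).length = 2 * m + 2 := by
      intro t
      rcases le_or_gt (2 * m + 1) t with ht | ht
      · simp [hend t ht, maxPath]
      · induction t with
        | zero => rw [h0, hl]
        | succ t ih => rw [← (h t (by omega)).1.1.1, ih (by omega)]
    refine ⟨hlen, isSmallDescent_downCount hlen (fun t => ?_) fun t => ?_⟩
    · rcases le_or_gt (2 * m + 1) t with ht | ht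
      · rw [hend t ht, hend (t + 1) (by omega)]
        exact pathLe_refl _
      · exact (h t ht).1.1
    · rcases le_or_gt (2 * m + 1) t with ht | ht
      · rw [hend t ht, hend (t + 1) (by omega)]
        exact pathLe_fill _
      · exact (h t ht).2
  · rintro ⟨hlen, hF⟩ t ht
    refine ⟨⟨(pathLe_iff_downCount _ _).2 ⟨by rw [hlen, hlen], fun x hx =>
      hF.anti t x (hlen t ▸ hx)⟩, fun he => ?_⟩, (pathLe_fill_iff (by rw [hlen, hlen])).2
      ⟨fun x hx => hF.right t x (hlen t ▸ hx), fun x hx => hF.left t x (hlen t ▸ hx)⟩⟩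
    obtain ⟨x, -, hx⟩ := hF.exists_ne (by rw [h0, hc]) (fun x _ => by
      rw [hend _ le_rfl, downCount_maxPath]) ht
    exact hx (by rw [← he])

/-! ### Elevated paths and multichains of type `V` -/

/-- The path `uPd`. -/
def elevate (P : BinPath) : BinPath := true :: (P ++ [false])

lemma length_elevate (P : BinPath) : (elevate P).length = P.length + 2 := by simp [elevate]

lemma downCount_elevate_succ (P : BinPath) (x : ℕ) (hx : x ≤ P.length) :
    downCount (elevate P) (x + 1) = downCount P x := by
  simp [downCount, elevate, List.take_append_of_le_length hx]

lemma downCount_elevate_last (P : BinPath) :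
    downCount (elevate P) (P.length + 2) = downCount P P.length + 1 := by
  rw [← downCount_elevate_succ P _ le_rfl, ← getD_eq_false_iff]
  simp [elevate]

lemma sameValleysUpTo_iff {P Q : BinPath} (h : pathLe P Q) (M : ℤ) :
    sameValleysUpTo P Q M ↔ ∀ x ≤ P.length, ∀ k, k ≤ downCount P x →
      (x : ℤ) - 2 * k ≤ M → k ≤ downCount Q x := by
  obtain ⟨hl, hle⟩ := (pathLe_iff_downCount P Q).1 h
  constructor
  · intro hV
    have key : ∀ n x k : ℕ, x + 2 * P.length - 2 * k = n → x ≤ P.length →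
        k ≤ downCount P x → (x : ℤ) - 2 * k ≤ M → k ≤ downCount Q x := by
      intro n
      induction n using Nat.strong_induction_on with
      | _ n ih =>
        intro x k hn hx hk hM
        have hb := downCount_le P x
        rcases hk.lt_or_eq with hlt | heq
        · have := ih _ (by omega) x (k + 1) rfl hx hlt (by push_cast; omega)
          omega
        · cases x with
          | zero => simp [downCount_zero] at heq; omega
          | succ x =>
            have p1 := downCount_le_succ P x
            have p2 := downCount_succ_le P x
            have p3 : downCount P (x + 1) ≤ downCount P (x + 2) := downCount_le_succ P (x + 1)
            have p4 : downCount P (x + 2) ≤ downCount P (x + 1) + 1 :=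
              downCount_succ_le P (x + 1)
            by_cases h1 : downCount P (x + 1) = downCount P x
            · have := ih _ (by omega) x k rfl (by omega) (by omega) (by push_cast at hM; omega)
              have := downCount_le_succ Q x
              omega
            · by_cases h2 : downCount P (x + 2) = downCount P (x + 1)
              · have hv := (hV x _ hM).1 ⟨(isValley_iff_downCount P x).2 ⟨by omega, h2⟩, by
                  rw [ht_eq_sub_downCount P _ hx, heq]⟩
                rw [ht_eq_sub_downCount Q _ (by omega)] at hv
                omega
              · have hx2 : x + 2 ≤ P.length := by
                  by_contra hx2
                  refine h2 ((getD_eq_true_iff P (x + 1)).1 (List.getD_eq_default _ _ (by omega)))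
                have := ih _ (by omega) (x + 2) (k + 1) rfl hx2 (by omega) (by
                  push_cast at hM ⊢; omega)
                have : downCount Q (x + 2) ≤ downCount Q (x + 1) + 1 :=
                  downCount_succ_le Q (x + 1)
                omega
    exact fun x hx k hk hM => key _ x k rfl hx hk hM
  · intro hc i t ht
    rw [isValley_iff_downCount, isValley_iff_downCount]
    by_cases hi : i < P.length
    · have hi : i + 1 ≤ P.length := hi
      rw [ht_eq_sub_downCount P _ hi, ht_eq_sub_downCount Q _ (hl ▸ hi)]
      have p1 := downCount_le_succ P i
      have p2 := downCount_succ_le P i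
      have p3 : downCount P (i + 1) ≤ downCount P (i + 2) := downCount_le_succ P (i + 1)
      have p4 : downCount P (i + 2) ≤ downCount P (i + 1) + 1 :=
        downCount_succ_le P (i + 1)
      have q1 := downCount_le_succ Q i
      have q2 := downCount_succ_le Q i
      have q3 : downCount Q (i + 1) ≤ downCount Q (i + 2) := downCount_le_succ Q (i + 1)
      have q4 : downCount Q (i + 2) ≤ downCount Q (i + 1) + 1 :=
        downCount_succ_le Q (i + 1)
      have c0 := hle i (by omega)
      have c1 := hle (i + 1) hi
      have c2 : downCount Q (i + 2) ≤ downCount P (i + 2) := by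
        by_cases hi2 : i + 2 ≤ P.length
        · exact hle _ hi2
        · have : downCount Q (i + 2) = downCount Q (i + 1) :=
            (getD_eq_true_iff Q (i + 1)).1 (List.getD_eq_default _ _ (by omega))
          omega
      push_cast
      constructor
      · rintro ⟨⟨h1, h2⟩, h3⟩
        have := hc (i + 1) hi _ le_rfl (by push_cast; omega)
        omega
      · rintro ⟨⟨h1, h2⟩, h3⟩
        have e1 : downCount P (i + 1) = downCount Q (i + 1) := by
          by_contra hne
          have := hc (i + 1) hi (downCount Q (i + 1) + 1) (by omega) (by push_cast; omega)
          omega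
        have e2 : downCount P i ≠ downCount P (i + 1) := by
          intro he
          have := hc i (by omega) (downCount P i) le_rfl (by omega)
          omega
        have e3 : downCount P (i + 2) = downCount P (i + 1) := by
          by_contra hne
          by_cases hi2 : i + 2 ≤ P.length
          · have := hc (i + 2) hi2 (downCount P (i + 2)) le_rfl (by push_cast; omega)
            omega
          · exact hne
              ((getD_eq_true_iff P (i + 1)).1 (List.getD_eq_default _ _ (by omega)))
        exact ⟨⟨by omega, e3⟩, by omega⟩
    · have hP := getD_eq_false_iff P i
      have hQ := getD_eq_false_iff Q i
      rw [List.getD_eq_default _ _ (by omega)] at hP hQ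
      constructor
      · rintro ⟨⟨h1, -⟩, -⟩
        simp [h1] at hP
      · rintro ⟨⟨h1, -⟩, -⟩
        simp [h1] at hQ

lemma ht_valley_le_hvNat {P : BinPath} {i : ℕ} (h : isValley P i) :
    ht P (i + 1) ≤ hvNat P := by
  have hle : ht P (i + 1) ≤ hv P := le_csSup ⟨(P.length : ℤ), ?_⟩ ⟨i, h, rfl⟩
  · exact hle.trans (Int.self_le_toNat _)
  rintro _ ⟨j, hj, rfl⟩
  rw [ht_eq_sub_downCount P _ hj.1]
  have := hj.1
  omega

/-- A point of `P` that lies above all valleys is next to a point of `P` on one side at least. -/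
lemma le_downCount_adjacent {P : BinPath} {x k : ℕ} (hx : x ≤ P.length)
    (h : k ≤ downCount P x) (hh : hvNat P + 2 * k < x) :
    k ≤ downCount P (x - 1) ∨ (x < P.length ∧ k + 1 ≤ downCount P (x + 1)) := by
  by_contra! hcon
  cases x with
  | zero => rw [downCount_zero] at h; omega
  | succ i =>
    simp only [Nat.add_sub_cancel] at hcon
    have p1 := downCount_succ_le P i
    have p2 : downCount P (i + 1) ≤ downCount P (i + 2) := downCount_le_succ P (i + 1)
    have hv : isValley P i := by
      refine (isValley_iff_downCount P i).2 ⟨by omega, ?_⟩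
      by_cases hx2 : i + 2 ≤ P.length
      · have p3 : downCount P (i + 2) < k + 1 := hcon.2 (by omega)
        omega
      · exact (getD_eq_true_iff P (i + 1)).1 (List.getD_eq_default _ _ (by omega))
    have := ht_valley_le_hvNat hv
    rw [ht_eq_sub_downCount P _ hx] at this
    omega

lemma le_of_forall_pos_le {a b : ℕ} (h : ∀ k, 1 ≤ k → k ≤ a → k ≤ b) : a ≤ b := by
  rcases Nat.eq_zero_or_pos a with rfl | ha
  · exact Nat.zero_le _
  · exact h a ha le_rfl

lemma eq_of_forall_le_downCount_iff {N : ℕ} {P Q : BinPath} (hP : P.length = N)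
    (hQ : Q.length = N)
    (h : ∀ x ≤ N, ∀ k, 1 ≤ k → (k ≤ downCount P x ↔ k ≤ downCount Q x)) : P = Q :=
  eq_of_downCount_eq (hP.trans hQ.symm) fun x hx =>
    le_antisymm (le_of_forall_pos_le fun k hk => (h x (hP ▸ hx) k hk).1)
      (le_of_forall_pos_le fun k hk => (h x (hP ▸ hx) k hk).2)

/-- Multichains of type `V` starting from `a`, extended by one more Dyck path and constant from
index `h + 1` on, in terms of downstep counts. -/
structure IsExtVChain (m h : ℕ) (a : BinPath) (ρ : ℕ → BinPath) : Prop where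
  zero : ρ 0 = a
  eq_last : ∀ j, h < j → ρ j = ρ (h + 1)
  length : ∀ j, (ρ j).length = 2 * m
  last : ∀ j, downCount (ρ j) (2 * m) = m
  anti : ∀ j, ∀ x ≤ 2 * m, downCount (ρ (j + 1)) x ≤ downCount (ρ j) x
  valley : ∀ j ≤ h, ∀ x ≤ 2 * m, ∀ k, k ≤ downCount (ρ j) x → x + j + 1 ≤ 2 * k + h →
    k ≤ downCount (ρ (j + 1)) x

namespace IsExtVChain

variable {m h : ℕ} {a : BinPath} {ρ : ℕ → BinPath}

lemma anti' (hρ : IsExtVChain m h a ρ) {x j j' : ℕ} (hx : x ≤ 2 * m) (hj : j ≤ j') :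
    downCount (ρ j') x ≤ downCount (ρ j) x := by
  induction j', hj using Nat.le_induction with
  | base => rfl
  | succ j' _ ih => exact (hρ.anti j' x hx).trans ih

lemma le_of_le_zero (hρ : IsExtVChain m h a ρ) {x j k : ℕ} (hx : x ≤ 2 * m) (hj : j ≤ h + 1)
    (hk : k ≤ downCount a x) (hjk : x + j ≤ 2 * k + h) : k ≤ downCount (ρ j) x := by
  induction j with
  | zero => rwa [hρ.zero]
  | succ j ih =>
    exact hρ.valley j (by omega) x hx k (ih (by omega) (by omega)) (by omega)

lemma elevate_last (hρ : IsExtVChain m h a ρ) (j : ℕ) :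
    downCount (elevate (ρ j)) (2 * m + 2) = m + 1 := by
  have := downCount_elevate_last (ρ j)
  rwa [hρ.length, hρ.last] at this

lemma elevate_succ (hρ : IsExtVChain m h a ρ) (j x : ℕ) (hx : x ≤ 2 * m) :
    downCount (elevate (ρ j)) (x + 1) = downCount (ρ j) x :=
  downCount_elevate_succ _ _ (by rwa [hρ.length])

lemma elevate_anti (hρ : IsExtVChain m h a ρ) {x j j' : ℕ} (hx : x ≤ 2 * m + 2)
    (hj : j ≤ j') : downCount (elevate (ρ j')) x ≤ downCount (elevate (ρ j)) x := by
  rcases x with _ | x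
  · simp [downCount_zero]
  · rcases (show x ≤ 2 * m ∨ x = 2 * m + 1 by omega) with hx' | rfl
    · rw [hρ.elevate_succ _ _ hx', hρ.elevate_succ _ _ hx']
      exact hρ.anti' hx' hj
    · rw [hρ.elevate_last, hρ.elevate_last]

lemma elevate_le_of_le_zero (hρ : IsExtVChain m h a ρ) {x j k : ℕ} (hx : x ≤ 2 * m + 2)
    (hj : j ≤ h + 1) (hk : k ≤ downCount (elevate a) x) (hjk : x + j ≤ 2 * k + h + 1) :
    k ≤ downCount (elevate (ρ j)) x := by
  rcases x with _ | x
  · simpa [downCount_zero] using hk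
  · rw [← hρ.zero] at hk
    rcases (show x ≤ 2 * m ∨ x = 2 * m + 1 by omega) with hx' | rfl
    · rw [hρ.elevate_succ _ _ hx', hρ.zero] at hk
      rw [hρ.elevate_succ _ _ hx']
      exact hρ.le_of_le_zero hx' hj hk (by omega)
    · rwa [hρ.elevate_last] at hk ⊢

end IsExtVChain

/-! ### Diagonal slicing -/

/-- The diagonal slices of a chain. -/
noncomputable def slices (m h : ℕ) (c : ℕ → BinPath) (j : ℕ) : BinPath :=
  pathOf (2 * m) fun x k => k ≤ downCount (c (x + min j (h + 1) - (2 * k + h))) (x + 1)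

/-- The chain with the given diagonal slices. -/
noncomputable def unslice (m h : ℕ) (ρ : ℕ → BinPath) (t : ℕ) : BinPath :=
  pathOf (2 * m + 2) fun x k => t + 2 * k ≤ x ∧
    k ≤ downCount (elevate (ρ (t + 2 * k + h + 1 - x))) x

section Slicing

variable {m : ℕ} {a : BinPath} {c ρ : ℕ → BinPath}

lemma downCount_smallChain_zero (hl : a.length = 2 * m) (hc : c ∈ smallChains m (elevate a))
    {x : ℕ} (hx : x ≤ 2 * m) : downCount (c 0) (x + 1) = downCount a x := by
  rw [hc.1, downCount_elevate_succ _ _ (by omega)]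

lemma downCount_smallChain_zero_last (hl : a.length = 2 * m) (ha : downCount a (2 * m) = m)
    (hc : c ∈ smallChains m (elevate a)) : downCount (c 0) (2 * m + 2) = m + 1 := by
  have := downCount_elevate_last a
  rwa [hl, ha, ← hc.1] at this

lemma le_downCount_slices (hl : a.length = 2 * m) (hc : c ∈ smallChains m (elevate a))
    (h : ℕ) {j x k : ℕ} (hx : x ≤ 2 * m) (hk : 1 ≤ k) :
    k ≤ downCount (slices m h c j) x ↔
      k ≤ downCount (c (x + min j (h + 1) - (2 * k + h))) (x + 1) := by
  have hF := hc.2.2.2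
  refine le_downCount_pathOf (fun k hk hE => ?_) (fun x k hx hk hE => ?_)
    (fun x k hx hk hE => ?_) hx hk
  · have h1 := hF.anti' (x := 1) (by omega) (Nat.zero_le (0 + min j (h + 1) - (2 * k + h)))
    have h2 := downCount_smallChain_zero hl hc (x := 0) (by omega)
    rw [downCount_zero] at h2
    simp only [Nat.zero_add] at *
    omega
  · have h1 := hF.right (x + min j (h + 1) - (2 * k + h)) (x + 1) (by omega)
    have h2 := hF.anti' (x := x + 1 + 1) (by omega)
      (show x + 1 + min j (h + 1) - (2 * k + h) ≤ x + min j (h + 1) - (2 * k + h) + 1 by omega)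
    exact hE.trans (h1.trans h2)
  · have h1 := hF.left (x + 1 + min j (h + 1) - (2 * (k + 1) + h)) (x + 1) (by omega)
    have h2 := hF.anti' (x := x + 1) (by omega)
      (show x + min j (h + 1) - (2 * k + h) ≤
        x + 1 + min j (h + 1) - (2 * (k + 1) + h) + 1 by omega)
    omega

/-- Boxes far above all valleys of the initial path are not filled early. -/
lemma le_smallChain_of_le_zero (hl : a.length = 2 * m) (ha : downCount a (2 * m) = m)
    (hc : c ∈ smallChains m (elevate a)) {t x k : ℕ} (hx : x ≤ 2 * m + 2)
    (h : k ≤ downCount (c 0) x) (htx : t + hvNat a + 1 + 2 * k ≤ x) :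
    k ≤ downCount (c t) x := by
  have hF := hc.2.2.2
  induction t generalizing x k with
  | zero => exact h
  | succ t ih =>
    obtain ⟨x, rfl⟩ := Nat.exists_eq_succ_of_ne_zero (by omega : x ≠ 0)
    rcases (show x ≤ 2 * m ∨ x = 2 * m + 1 by omega) with hx' | rfl
    · rw [Nat.succ_eq_add_one, downCount_smallChain_zero hl hc hx'] at h
      rcases le_downCount_adjacent (by omega) h (by omega) with h1 | ⟨h1, h2⟩
      · obtain ⟨x, rfl⟩ := Nat.exists_eq_succ_of_ne_zero (by omega : x ≠ 0)
        refine (ih (x := x + 1) (by omega) ?_ (by omega)).trans (hF.right t (x + 1) (by omega))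
        rw [downCount_smallChain_zero hl hc (by omega)]
        exact h1
      · rw [← downCount_smallChain_zero hl hc (by omega)] at h2
        have h3 := ih (x := x + 1 + 1) (k := k + 1) (by omega) h2 (by omega)
        have h4 := hF.left t (x + 1) (by omega)
        exact Nat.le_of_succ_le_succ (h3.trans h4)
    · have h0 := downCount_smallChain_zero_last hl ha hc
      have h1 := hF.le_last h0 (k := k) (by
        change k ≤ downCount (c 0) (2 * m + 2) at h
        omega)
      exact h1.trans (hF.anti' le_rfl (by omega))

lemma slices_mem (hl : a.length = 2 * m) (ha : downCount a (2 * m) = m)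
    (hc : c ∈ smallChains m (elevate a)) :
    IsExtVChain m (hvNat a) a (slices m (hvNat a) c) := by
  have hF := hc.2.2.2
  have h0 := downCount_smallChain_zero_last hl ha hc
  have hanti : ∀ t t' x, x ≤ 2 * m + 2 → t ≤ t' → downCount (c t') x ≤ downCount (c t) x :=
    fun t t' x hx htt => hF.anti' hx htt
  refine ⟨?_, fun j hj => ?_, fun j => length_pathOf _ _, fun j => ?_, fun j x hx => ?_,
    fun j hj x hx k hk hjk => ?_⟩
  · refine eq_of_forall_le_downCount_iff (length_pathOf _ _) hl fun x hx k hk => ?_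
    rw [le_downCount_slices hl hc _ hx hk, ← downCount_smallChain_zero hl hc hx]
    refine ⟨fun h => h.trans (hanti _ _ _ (by omega) (Nat.zero_le _)), fun h => ?_⟩
    rcases Nat.eq_zero_or_pos (x + min 0 (hvNat a + 1) - (2 * k + hvNat a)) with h1 | h1
    · rwa [h1]
    · exact le_smallChain_of_le_zero hl ha hc (by omega) h (by omega)
  · unfold slices
    rw [min_eq_right (by omega : hvNat a + 1 ≤ j), min_self]
  · refine le_antisymm (le_of_forall_pos_le fun k hk h => ?_)
      (le_of_forall_pos_le fun k hk h => ?_)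
    · rw [le_downCount_slices hl hc _ le_rfl hk] at h
      have h1 := h.trans (hanti 0 _ _ (by omega) (Nat.zero_le _))
      rwa [downCount_smallChain_zero hl hc le_rfl, ha] at h1
    · rw [le_downCount_slices hl hc _ le_rfl hk]
      exact (hF.le_penultimate h0 h).trans (hF.anti' (by omega) (by omega))
  · refine le_of_forall_pos_le fun k hk h => ?_
    rw [le_downCount_slices hl hc _ hx hk] at h ⊢
    exact h.trans (hanti _ _ _ (by omega) (by omega))
  · rcases Nat.eq_zero_or_pos k with rfl | hk1
    · exact Nat.zero_le _
    · rw [le_downCount_slices hl hc _ hx hk1] at hk ⊢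
      exact hk.trans (hanti _ _ _ (by omega) (by omega))

lemma le_downCount_unslice {h : ℕ} (hρ : IsExtVChain m h a ρ) {t x k : ℕ}
    (hx : x ≤ 2 * m + 2) (hk : 1 ≤ k) :
    k ≤ downCount (unslice m h ρ t) x ↔
      t + 2 * k ≤ x ∧ k ≤ downCount (elevate (ρ (t + 2 * k + h + 1 - x))) x := by
  refine le_downCount_pathOf (E := fun x k => t + 2 * k ≤ x ∧
    k ≤ downCount (elevate (ρ (t + 2 * k + h + 1 - x))) x) (fun k hk hE => ?_)
    (fun x k hx hk hE => ?_) (fun x k hx hk hE => ?_) hx hk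
  · have := hE.1
    omega
  · refine ⟨by omega, hE.2.trans ((downCount_le_succ _ _).trans ?_)⟩
    exact hρ.elevate_anti (by omega) (by omega)
  · refine ⟨by omega, ?_⟩
    have h1 := downCount_succ_le (elevate (ρ (t + 2 * (k + 1) + h + 1 - (x + 1)))) x
    have h2 := hρ.elevate_anti (x := x) (by omega)
      (show t + 2 * k + h + 1 - x ≤ t + 2 * (k + 1) + h + 1 - (x + 1) by omega)
    omega

lemma two_mul_le_of_le_elevate (hl : a.length = 2 * m) (ha : downCount a (2 * m) = m)
    (hd : ∀ x ≤ 2 * m, 2 * downCount a x ≤ x) {x : ℕ} (hx : x ≤ 2 * m + 2) :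
    2 * downCount (elevate a) x ≤ x := by
  rcases x with _ | x
  · simp [downCount_zero]
  · rcases (show x ≤ 2 * m ∨ x = 2 * m + 1 by omega) with hx' | rfl
    · rw [downCount_elevate_succ _ _ (by omega)]
      have := hd x hx'
      omega
    · have := downCount_elevate_last a
      rw [hl, ha] at this
      rw [this]
      omega

lemma unslice_mem {h : ℕ} (hl : a.length = 2 * m) (ha : downCount a (2 * m) = m)
    (hd : ∀ x ≤ 2 * m, 2 * downCount a x ≤ x) (hρ : IsExtVChain m h a ρ) :
    unslice m h ρ ∈ smallChains m (elevate a) := by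
  refine ⟨?_, fun t ht => ?_, fun t => length_pathOf _ _, fun t => downCount_zero _,
    fun t x hx => ?_, fun t x hx => ?_, fun t x hx => ?_⟩
  · refine eq_of_forall_le_downCount_iff (length_pathOf _ _)
      (by rw [length_elevate, hl]) fun x hx k hk => ?_
    rw [le_downCount_unslice hρ hx hk]
    constructor
    · rintro ⟨-, h2⟩
      have := h2.trans (hρ.elevate_anti hx (Nat.zero_le _))
      rwa [hρ.zero] at this
    · intro h1
      have h2 := two_mul_le_of_le_elevate hl ha hd hx
      refine ⟨by omega, ?_⟩
      rcases le_total x (2 * k + h + 1) with h3 | h3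
      · exact hρ.elevate_le_of_le_zero hx (by omega) h1 (by omega)
      · rwa [show 0 + 2 * k + h + 1 - x = 0 by omega, hρ.zero]
  · have h1 := eq_maxPath_of_downCount (P := unslice m h ρ t) fun x hx => by
      have hlen : (unslice m h ρ t).length = 2 * m + 2 := length_pathOf _ _
      by_contra hne
      have := ((le_downCount_unslice hρ (by omega) (Nat.one_le_iff_ne_zero.2 hne)).1 le_rfl).1
      omega
    rw [h1]
    congr 1
    exact length_pathOf _ _
  · refine le_of_forall_pos_le fun k hk h1 => ?_
    rw [le_downCount_unslice hρ hx hk] at h1 ⊢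
    exact ⟨by omega, h1.2.trans (hρ.elevate_anti hx (by omega))⟩
  · refine le_of_forall_pos_le fun k hk h1 => ?_
    rw [le_downCount_unslice hρ (by omega) hk] at h1 ⊢
    exact ⟨by omega, h1.2.trans ((downCount_le_succ _ _).trans
      (hρ.elevate_anti (by omega) (by omega)))⟩
  · rw [← Nat.sub_le_iff_le_add]
    refine le_of_forall_pos_le fun k hk h1 => ?_
    have h1 : k + 1 ≤ downCount (unslice m h ρ t) (x + 1) := by omega
    rw [le_downCount_unslice hρ (by omega) (by omega)] at h1
    rw [le_downCount_unslice hρ (by omega) hk]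
    refine ⟨by omega, ?_⟩
    have h2 := downCount_succ_le (elevate (ρ (t + 2 * (k + 1) + h + 1 - (x + 1)))) x
    have h3 := hρ.elevate_anti (x := x) (by omega)
      (show t + 1 + 2 * k + h + 1 - x ≤ t + 2 * (k + 1) + h + 1 - (x + 1) by omega)
    omega

lemma unslice_slices (hl : a.length = 2 * m) (ha : downCount a (2 * m) = m)
    (hc : c ∈ smallChains m (elevate a)) :
    unslice m (hvNat a) (slices m (hvNat a) c) = c := by
  have hF := hc.2.2.2
  have h0 := downCount_smallChain_zero_last hl ha hc
  have hρ := slices_mem hl ha hc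
  have hanti : ∀ t t' x, x ≤ 2 * m + 2 → t ≤ t' → downCount (c t') x ≤ downCount (c t) x :=
    fun t t' x hx htt => hF.anti' hx htt
  have hend : ∀ x ≤ 2 * m + 2, downCount (c (2 * m + 2 - 1)) x = 0 := fun x _ => by
    rw [hc.2.1 _ (by omega), downCount_maxPath]
  have hslice : ∀ j x k, j ≤ hvNat a + 1 → x ≤ 2 * m + 2 → 1 ≤ k →
      (k ≤ downCount (elevate (slices m (hvNat a) c j)) x ↔
        k ≤ downCount (c (x + j - (2 * k + hvNat a + 1))) x) := by
    intro j x k hj hx hk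
    rcases x with _ | x
    · simp [downCount_zero]
    · rcases (show x ≤ 2 * m ∨ x = 2 * m + 1 by omega) with hx' | rfl
      · rw [hρ.elevate_succ _ _ hx', le_downCount_slices hl hc _ hx' hk, min_eq_left hj,
          show x + 1 + j - (2 * k + hvNat a + 1) = x + j - (2 * k + hvNat a) by omega]
      · rw [hρ.elevate_last]
        constructor
        · intro h1
          exact (hF.le_last h0 h1).trans (hanti _ _ _ hx (by omega))
        · intro h1
          have := h1.trans (hanti 0 _ _ hx (Nat.zero_le _))
          change k ≤ downCount (c 0) (2 * m + 2) at this
          omega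
  funext t
  refine eq_of_forall_le_downCount_iff (length_pathOf _ _) (hc.2.2.1 t) fun x hx k hk => ?_
  rw [le_downCount_unslice hρ hx hk]
  have hiff : t + 2 * k ≤ x → (k ≤ downCount (elevate
      (slices m (hvNat a) c (t + 2 * k + hvNat a + 1 - x))) x ↔ k ≤ downCount (c t) x) := by
    intro htx
    rw [hslice _ _ _ (by omega) hx hk]
    rcases le_total x (t + 2 * k + hvNat a + 1) with h1 | h1
    · rw [show x + (t + 2 * k + hvNat a + 1 - x) - (2 * k + hvNat a + 1) = t by omega]
    · constructor <;> intro h2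
      · exact le_smallChain_of_le_zero hl ha hc hx
          (h2.trans (hanti _ _ _ hx (Nat.zero_le _))) (by omega)
      · exact le_smallChain_of_le_zero hl ha hc hx
          (h2.trans (hanti _ _ _ hx (Nat.zero_le _))) (by omega)
  exact ⟨fun h1 => (hiff h1.1).1 h1.2, fun h1 =>
    have h2 := hF.add_two_mul_le hend hx hk h1
    ⟨h2, (hiff h2).2 h1⟩⟩

lemma slices_unslice {h : ℕ} (hl : a.length = 2 * m) (ha : downCount a (2 * m) = m)
    (hd : ∀ x ≤ 2 * m, 2 * downCount a x ≤ x) (hρ : IsExtVChain m h a ρ) :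
    slices m h (unslice m h ρ) = ρ := by
  have hc := unslice_mem hl ha hd hρ
  funext j
  have hj : ρ j = ρ (min j (h + 1)) := by
    rcases le_or_gt j (h + 1) with hj | hj
    · rw [min_eq_left hj]
    · rw [min_eq_right hj.le, hρ.eq_last j (by omega)]
  rw [hj]
  refine eq_of_forall_le_downCount_iff (length_pathOf _ _) (hρ.length _) fun x hx k hk => ?_
  rw [le_downCount_slices hl hc _ hx hk, le_downCount_unslice hρ (by omega) hk,
    hρ.elevate_succ _ _ hx]
  generalize hi : min j (h + 1) = i
  have hi' : i ≤ h + 1 := by omega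
  rcases le_total (2 * k + h) (x + i) with h1 | h1
  · rw [show x + i - (2 * k + h) + 2 * k + h + 1 - (x + 1) = i by omega]
    exact ⟨fun h2 => h2.2, fun h2 => ⟨by omega, h2⟩⟩
  · have hzero : ∀ i', k ≤ downCount (ρ i') x → k ≤ downCount a x := fun i' h2 => by
      have := h2.trans (hρ.anti' hx (Nat.zero_le i'))
      rwa [hρ.zero] at this
    constructor
    · exact fun h2 => hρ.le_of_le_zero hx hi' (hzero _ h2.2) (by omega)
    · intro h2
      have h3 := hzero _ h2
      have h4 := hd x hx
      exact ⟨by omega, hρ.le_of_le_zero hx (by omega) h3 (by omega)⟩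

lemma ncard_smallChains (hl : a.length = 2 * m) (ha : downCount a (2 * m) = m)
    (hd : ∀ x ≤ 2 * m, 2 * downCount a x ≤ x) :
    (smallChains m (elevate a)).ncard = {ρ | IsExtVChain m (hvNat a) a ρ}.ncard :=
  Set.ncard_congr (fun c _ => slices m (hvNat a) c) (fun _ hc => slices_mem hl ha hc)
    (fun c c' hc hc' h => by
      rw [← unslice_slices hl ha hc, ← unslice_slices hl ha hc', h])
    (fun ρ hρ => ⟨_, unslice_mem hl ha hd hρ, slices_unslice hl ha hd hρ⟩)

end Slicing

/-! ### Counting by the last member of the multichain -/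

lemma downCount_pyramid (m x : ℕ) (hx : x ≤ 2 * m) : downCount (pyramid m) x = x - m := by
  simp [downCount, pyramid, List.take_append, List.take_replicate, List.count_replicate]
  omega

lemma downCount_add_le (P : BinPath) (x i : ℕ) :
    downCount P (x + i) ≤ downCount P x + i := by
  induction i with
  | zero => rfl
  | succ i ih => have := downCount_succ_le P (x + i); rw [← add_assoc]; omega

lemma isDyck_iff_of_length {m : ℕ} {P : BinPath} (hl : P.length = 2 * m) :
    IsDyck P ↔ downCount P (2 * m) = m ∧ ∀ x ≤ 2 * m, 2 * downCount P x ≤ x := by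
  rw [isDyck_iff_downCount, hl]
  exact and_congr_left fun _ => by omega

lemma IsExtVChain.isDyck {m h : ℕ} {a : BinPath} {ρ : ℕ → BinPath}
    (hρ : IsExtVChain m h a ρ) (hd : ∀ x ≤ 2 * m, 2 * downCount a x ≤ x) (j : ℕ) :
    IsDyck (ρ j) :=
  (isDyck_iff_of_length (hρ.length j)).2 ⟨hρ.last j, fun x hx => by
    have h1 := hρ.anti' hx (Nat.zero_le j)
    have h2 := hd x hx
    rw [hρ.zero] at h1
    omega⟩

lemma IsExtVChain.pathLe {m h : ℕ} {a : BinPath} {ρ : ℕ → BinPath}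
    (hρ : IsExtVChain m h a ρ) {j j' : ℕ} (hj : j ≤ j') : pathLe (ρ j) (ρ j') :=
  (pathLe_iff_downCount _ _).2 ⟨by rw [hρ.length, hρ.length], fun x hx =>
    hρ.anti' (hρ.length j ▸ hx) hj⟩

/-- Append `p.2` to the multichain `p.1`. -/
def appendChain (h : ℕ) (p : (ℕ → BinPath) × BinPath) (j : ℕ) : BinPath :=
  if j ≤ h then p.1 j else p.2

lemma ncard_fiber {m : ℕ} {a s : BinPath} (hl : a.length = 2 * m)
    (ha : downCount a (2 * m) = m) (hd : ∀ x ≤ 2 * m, 2 * downCount a x ≤ x)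
    (hs : s.length = 2 * m) :
    {ρ | IsExtVChain m (hvNat a) a ρ ∧ ρ (hvNat a) = s}.ncard = VPath a s * Ifun s := by
  unfold VPath Ifun intervalCard
  rw [← Set.ncard_prod]
  symm
  refine Set.ncard_congr (fun p _ => appendChain (hvNat a) p) ?_ ?_ ?_
  · rintro ⟨σ, R⟩ ⟨⟨h0, hlast, hdyck, hle, hval⟩, hsR, hR⟩
    dsimp only at h0 hlast hdyck hle hval hsR hR
    rw [hs, show 2 * m / 2 = m by omega] at hR
    have hsh := hlast _ le_rfl
    have hlen : ∀ j, (σ j).length = 2 * m := by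
      intro j
      rcases le_or_gt (hvNat a) j with hj | hj
      · rw [hlast j hj, hs]
      · induction j with
        | zero => rw [h0, hl]
        | succ j ih => rw [← (hle j (by omega)).1, ih (by omega)]
    have hdy := fun j => (isDyck_iff_of_length (hlen j)).1 (hdyck j)
    obtain ⟨hl1, hsR⟩ := (pathLe_iff_downCount _ _).1 hsR
    obtain ⟨-, hR⟩ := (pathLe_iff_downCount _ _).1 hR
    rw [hs] at hl1 hsR
    rw [← hl1] at hR
    refine ⟨⟨?_, fun j hj => ?_, fun j => ?_, fun j => ?_, fun j x hx => ?_,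
      fun j hj x hx k hk hjk => ?_⟩, ?_⟩
    · simp [appendChain, h0]
    · simp [appendChain, hj]
    · unfold appendChain
      split_ifs
      · exact hlen j
      · exact hl1.symm
    · unfold appendChain
      split_ifs
      · exact (hdy j).1
      · have h1 := hsR _ le_rfl
        have h2 := hR _ le_rfl
        have h3 := (hdy (hvNat a)).1
        rw [hsh] at h3
        rw [downCount_pyramid _ _ le_rfl] at h2
        dsimp only
        omega
    · unfold appendChain
      split_ifs with h1 h2 h2
      · exact ((pathLe_iff_downCount _ _).1 (hle j (by omega))).2 x (by rwa [hlen])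
      · omega
      · obtain rfl : j = hvNat a := by omega
        dsimp only
        rw [hsh]
        exact hsR x hx
      · exact le_rfl
    · unfold appendChain at hk ⊢
      rw [if_pos hj] at hk
      split_ifs with h1
      · have hv := hval (j + 1) (by omega) h1
        rw [Nat.add_sub_cancel, sameValleysUpTo_iff (hle j (by omega))] at hv
        exact hv x (by rwa [hlen]) k hk (by push_cast; omega)
      · have := (hdy j).2 x hx
        dsimp only at hk
        omega
    · simp [appendChain, hsh]
  · rintro ⟨σ, R⟩ ⟨σ', R'⟩ ⟨hσ, -⟩ ⟨hσ', -⟩ h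
    refine Prod.ext (funext fun j => ?_) ?_
    · rcases le_or_gt (hvNat a) j with hj | hj
      · exact (hσ.2.1 j hj).trans (hσ'.2.1 j hj).symm
      · have := congrFun h j
        simpa [appendChain, hj.le] using this
    · have := congrFun h (hvNat a + 1)
      simpa [appendChain] using this
  · rintro ρ ⟨hρ, hρs⟩
    refine ⟨(fun j => ρ (min j (hvNat a)), ρ (hvNat a + 1)),
      ⟨⟨?_, fun j hj => ?_, fun j => hρ.isDyck hd _, fun j hj => hρ.pathLe (by omega),
        fun j hj1 hj => ?_⟩, ?_, ?_⟩, ?_⟩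
    · simp [hρ.zero]
    · simp [hj, hρs]
    · dsimp only
      rw [min_eq_left hj, min_eq_left (by omega), sameValleysUpTo_iff (hρ.pathLe (by omega))]
      intro x hx k hk hM
      rw [hρ.length] at hx
      have := hρ.valley (j - 1) (by omega) x hx k hk (by omega)
      rwa [Nat.sub_add_cancel hj1] at this
    · rw [← hρs]
      exact hρ.pathLe (by omega)
    · rw [hs, show 2 * m / 2 = m by omega]
      refine (pathLe_iff_downCount _ _).2 ⟨?_, fun x hx => ?_⟩
      · simp [hρ.length, pyramid]
        omega
      · dsimp only at hx ⊢
        rw [hρ.length] at hx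
        have h1 := downCount_add_le (ρ (hvNat a + 1)) x (2 * m - x)
        rw [show x + (2 * m - x) = 2 * m by omega, hρ.last] at h1
        rw [downCount_pyramid m x hx]
        omega
    · funext j
      unfold appendChain
      split_ifs with hj
      · simp [hj]
      · exact (hρ.eq_last j (by omega)).symm

lemma finite_isExtVChain (m h : ℕ) (a : BinPath) : {ρ | IsExtVChain m h a ρ}.Finite := by
  have hfin : (Set.univ.pi fun _ : Fin (h + 2) => {P : BinPath | P.length = 2 * m}).Finite :=
    Set.Finite.pi fun _ => List.finite_length_eq Bool (2 * m)
  refine Set.Finite.of_finite_image (f := fun ρ (i : Fin (h + 2)) => ρ i) (hfin.subset ?_) ?_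
  · rintro _ ⟨ρ, hρ, rfl⟩ i -
    exact hρ.length i
  · intro ρ hρ ρ' hρ' he
    have hs : ∀ j, j < h + 2 → ρ j = ρ' j := fun j hj => congrFun he ⟨j, hj⟩
    funext j
    rcases lt_or_ge j (h + 2) with hj | hj
    · exact hs j hj
    · rw [hρ.eq_last j (by omega), hρ'.eq_last j (by omega), hs _ (by omega)]

/-- For every Dyck path `a`,
`f(uad) = Σ_{s ≥ a} V(a,s)·I(s)`, summed over Dyck paths `s` of length `|a|`
with `s ≥ a`. -/
theorem statement16 (a : BinPath) (ha : IsDyck a) :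
    fPath (true :: (a ++ [false]))
      = ∑ᶠ (s : BinPath) (_ : IsDyck s ∧ s.length = a.length ∧ pathLe a s),
          VPath a s * Ifun s := by
  classical
  obtain ⟨hl', hd⟩ := (isDyck_iff_downCount a).1 ha
  obtain ⟨m, hm⟩ : ∃ m, m = downCount a a.length := ⟨_, rfl⟩
  have hl : a.length = 2 * m := by omega
  rw [hl] at hm hd
  have helast := downCount_elevate_last a
  rw [hl, ← hm] at helast
  change fPath (elevate a) = _
  rw [fPath_eq_ncard_smallChains (by rw [length_elevate, hl]) helast
    fun x hx => two_mul_le_of_le_elevate hl hm.symm hd hx, ncard_smallChains hl hm.symm hd]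
  have hfin : {s : BinPath | IsDyck s ∧ s.length = a.length ∧ pathLe a s}.Finite :=
    (List.finite_length_eq Bool a.length).subset fun s hs => hs.2.1
  change _ = ∑ᶠ s ∈ {s : BinPath | IsDyck s ∧ s.length = a.length ∧ pathLe a s},
    VPath a s * Ifun s
  have hT := finite_isExtVChain m (hvNat a) a
  rw [finsum_mem_eq_finite_toFinset_sum _ hfin, Set.ncard_eq_toFinset_card _ hT,
    Finset.card_eq_sum_card_fiberwise (f := fun ρ => ρ (hvNat a)) (t := hfin.toFinset)]
  · refine Finset.sum_congr rfl fun s hs => ?_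
    rw [← ncard_fiber hl hm.symm hd (hl ▸ (hfin.mem_toFinset.1 hs).2.1),
      ← Set.ncard_coe_finset]
    congr 1
    ext ρ
    simp
  · intro ρ hρ
    have hρ : IsExtVChain m (hvNat a) a ρ := hT.mem_toFinset.1 hρ
    have hle := hρ.pathLe (Nat.zero_le (hvNat a))
    rw [hρ.zero] at hle
    exact hfin.mem_toFinset.2 ⟨hρ.isDyck hd _, hle.1.symm, hle⟩
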